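/- Let {X_i}_{i∈I} be a family of nonempty T₀ spaces. Then the product space ∏_{i∈I} X_i is well-filtered if and only if X_i is well-filtered for every i ∈ I. -/

import Mathlib

universe u v

open Set TopologicalSpace

/-- The upper set `↑A` of a subset `A` in the specialization preorder of a topological
space, where `x ≤ y` iff `x ∈ closure {y}`. -/
def upSet (X : Type u) [TopologicalSpace X] (A : Set X) : Set X :=
  {y | ∃ a ∈ A, a ∈ closure ({y} : Set X)}

/-- The lower set `↓A` of a subset `A` in the specialization preorder. -/
def downSet (X : Type u) [TopologicalSpace X] (A : Set X) : Set X :=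
  {y | ∃ a ∈ A, y ∈ closure ({a} : Set X)}

/-- A subset `D` is directed in the specialization preorder (`x ≤ y` iff
`x ∈ closure {y}`): it is nonempty and each two members have an upper bound in `D`. -/
def SpecDirected {X : Type u} [TopologicalSpace X] (D : Set X) : Prop :=
  D.Nonempty ∧ ∀ a ∈ D, ∀ b ∈ D, ∃ c ∈ D,
    a ∈ closure ({c} : Set X) ∧ b ∈ closure ({c} : Set X)

/-- `x` is a supremum of `D` in the specialization preorder. -/
def IsSpecSup {X : Type u} [TopologicalSpace X] (D : Set X) (x : X) : Prop :=
  (∀ d ∈ D, d ∈ closure ({x} : Set X)) ∧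
    ∀ y : X, (∀ d ∈ D, d ∈ closure ({y} : Set X)) → x ∈ closure ({y} : Set X)

/-- A `d`-space: the specialization poset is a dcpo and every open set is Scott open,
i.e. inaccessible by suprema of directed sets. -/
def DSpace (X : Type u) [TopologicalSpace X] : Prop :=
  (∀ D : Set X, SpecDirected D → ∃ x : X, IsSpecSup D x) ∧
    ∀ U : Set X, IsOpen U → ∀ D : Set X, SpecDirected D → ∀ x : X,
      IsSpecSup D x → x ∈ U → (D ∩ U).Nonempty

/-- A nonempty compact saturated subset (saturated = upper set in the
specialization preorder). -/
def IsCompactSaturated {X : Type u} [TopologicalSpace X] (K : Set X) : Prop :=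
  K.Nonempty ∧ IsCompact K ∧ ∀ x ∈ K, ∀ y : X, x ∈ closure ({y} : Set X) → y ∈ K

/-- A filtered family of nonempty compact saturated sets: a nonempty family,
directed under reverse inclusion. -/
def FilteredFamily {X : Type u} [TopologicalSpace X] (𝒦 : Set (Set X)) : Prop :=
  𝒦.Nonempty ∧ (∀ K ∈ 𝒦, IsCompactSaturated K) ∧
    ∀ K₁ ∈ 𝒦, ∀ K₂ ∈ 𝒦, ∃ K₃ ∈ 𝒦, K₃ ⊆ K₁ ∧ K₃ ⊆ K₂

/-- A well-filtered space. -/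
def WellFiltered (X : Type u) [TopologicalSpace X] : Prop :=
  ∀ 𝒦 : Set (Set X), FilteredFamily 𝒦 →
    ∀ U : Set X, IsOpen U → ⋂₀ 𝒦 ⊆ U → ∃ K ∈ 𝒦, K ⊆ U

/-- A sober space: every irreducible closed subset is the closure of a unique point. -/
def SoberSpace (X : Type u) [TopologicalSpace X] : Prop :=
  ∀ A : Set X, IsIrreducible A → IsClosed A → ∃! x : X, closure ({x} : Set X) = A

/-- The underlying set of the Smyth power space: all nonempty compact saturated subsets. -/
abbrev KSp (X : Type u) [TopologicalSpace X] : Type u := {K : Set X // IsCompactSaturated K}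

/-- The Smyth power space `P_S(X)`: `K(X)` with the upper Vietoris topology, generated
by the sets `□U = {K : K ⊆ U}` for `U` open in `X`. -/
instance KSp.instTopologicalSpace (X : Type u) [TopologicalSpace X] :
    TopologicalSpace (KSp X) :=
  .generateFrom {S : Set (KSp X) | ∃ U : Set X, IsOpen U ∧ S = {K : KSp X | K.1 ⊆ U}}

/-- A Rudin set: a closed set which is minimal (under inclusion) among the closed sets
meeting every member of some filtered family of nonempty compact saturated sets. -/
def IsRudinSet {X : Type u} [TopologicalSpace X] (A : Set X) : Prop :=
  IsClosed A ∧ ∃ 𝒦 : Set (Set X), FilteredFamily 𝒦 ∧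
    (∀ K ∈ 𝒦, (A ∩ K).Nonempty) ∧
    ∀ B : Set X, IsClosed B → (∀ K ∈ 𝒦, (B ∩ K).Nonempty) → B ⊆ A → B = A

/-- A Rudin space: every irreducible closed subset is a Rudin set. -/
def RudinSpace (X : Type u) [TopologicalSpace X] : Prop :=
  ∀ A : Set X, IsIrreducible A → IsClosed A → IsRudinSet A

/-- A well-filtered determined (WD) set: for every continuous map into a well-filtered
space, the closure of the image is the closure of a unique point. -/
def IsWDSet {X : Type u} [TopologicalSpace X] (A : Set X) : Prop :=
  ∀ (Y : Type u) [TopologicalSpace Y], WellFiltered Y →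
    ∀ f : X → Y, Continuous f → ∃! y : Y, closure (f '' A) = closure ({y} : Set Y)

/-- A well-filtered determined (WD) space: every irreducible closed subset is a WD set. -/
def WDSpace (X : Type u) [TopologicalSpace X] : Prop :=
  ∀ A : Set X, IsIrreducible A → IsClosed A → IsWDSet A

/-- A DC space: every irreducible closed subset is the closure of a set which is
directed in the specialization preorder. -/
def DCSpace (X : Type u) [TopologicalSpace X] : Prop :=
  ∀ A : Set X, IsIrreducible A → IsClosed A → ∃ D : Set X, SpecDirected D ∧ A = closure D

/-- Local compactness: every open neighbourhood of a point contains a compact saturated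
neighbourhood of the point. -/
def LocallyCompactSat (X : Type u) [TopologicalSpace X] : Prop :=
  ∀ x : X, ∀ U : Set X, IsOpen U → x ∈ U →
    ∃ K : Set X, IsCompactSaturated K ∧ x ∈ interior K ∧ K ⊆ U

/-- Core compactness: for every point `x` and open `U ∋ x` there is an open `V ∋ x`
way below `U`: every open cover of `U` has a finite subfamily covering `V`. -/
def CoreCompact (X : Type u) [TopologicalSpace X] : Prop :=
  ∀ x : X, ∀ U : Set X, IsOpen U → x ∈ U →
    ∃ V : Set X, IsOpen V ∧ x ∈ V ∧
      ∀ 𝒞 : Set (Set X), (∀ W ∈ 𝒞, IsOpen W) → U ⊆ ⋃₀ 𝒞 →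
        ∃ 𝒟 : Set (Set X), 𝒟 ⊆ 𝒞 ∧ 𝒟.Finite ∧ V ⊆ ⋃₀ 𝒟

open Filter Topology

theorem upSet_eq_nhdsKer {X : Type u} [TopologicalSpace X] (A : Set X) :
    upSet X A = nhdsKer A := by
  ext y
  simp only [upSet, mem_ofPred_eq, mem_nhdsKer_iff_specializes, specializes_iff_mem_closure]

/-- The upper set of a nonempty compact set is nonempty, compact and saturated. -/
theorem IsCompact.isCompactSaturated_upSet {X : Type u} [TopologicalSpace X] {C : Set X}
    (hC : IsCompact C) (hne : C.Nonempty) : IsCompactSaturated (upSet X C) := by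
  refine ⟨?_, ?_, ?_⟩
  · obtain ⟨c, hc⟩ := hne
    exact ⟨c, c, hc, subset_closure rfl⟩
  · rw [upSet_eq_nhdsKer]
    exact IsCompact.nhdsKer_iff.2 hC
  · rintro x ⟨a, ha, hax⟩ y hxy
    rw [← specializes_iff_mem_closure] at hax hxy
    exact ⟨a, ha, specializes_iff_mem_closure.1 (hxy.trans hax)⟩

theorem upSet_mono {X : Type u} [TopologicalSpace X] {A B : Set X} (h : A ⊆ B) :
    upSet X A ⊆ upSet X B :=
  fun _ ⟨a, ha, hay⟩ => ⟨a, h ha, hay⟩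

theorem subset_upSet {X : Type u} [TopologicalSpace X] (A : Set X) : A ⊆ upSet X A :=
  fun a ha => ⟨a, ha, subset_closure rfl⟩

/-- A monotone assignment of compact nonempty sets turns a filtered family into the
filtered family of the upper sets of its values. -/
theorem FilteredFamily.image_upSet {X : Type u} {Y : Type v} [TopologicalSpace X]
    [TopologicalSpace Y] {𝒦 : Set (Set X)} (h𝒦 : FilteredFamily 𝒦) (F : Set X → Set Y)
    (hmono : Monotone F) (hF : ∀ K ∈ 𝒦, IsCompact (F K) ∧ (F K).Nonempty) :
    FilteredFamily ((fun K => upSet Y (F K)) '' 𝒦) := by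
  refine ⟨h𝒦.1.image _, ?_, ?_⟩
  · rintro _ ⟨K, hK, rfl⟩
    exact (hF K hK).1.isCompactSaturated_upSet (hF K hK).2
  · rintro _ ⟨K₁, h₁, rfl⟩ _ ⟨K₂, h₂, rfl⟩
    obtain ⟨K₃, h₃, h₃₁, h₃₂⟩ := h𝒦.2.2 K₁ h₁ K₂ h₂
    exact ⟨_, mem_image_of_mem _ h₃, upSet_mono (hmono h₃₁), upSet_mono (hmono h₃₂)⟩

/-- A retract of a well-filtered space is well-filtered. -/
theorem WellFiltered.of_leftInverse {X : Type u} {Y : Type v} [TopologicalSpace X]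
    [TopologicalSpace Y] (hY : WellFiltered Y) {e : X → Y} {r : Y → X} (he : Continuous e)
    (hr : Continuous r) (hre : Function.LeftInverse r e) : WellFiltered X := by
  intro 𝒦 h𝒦 U hU hsub
  have hfam := h𝒦.image_upSet (fun K => e '' K) (fun _ _ h => image_mono h)
    fun K hK => ⟨(h𝒦.2.1 K hK).2.1.image he, (h𝒦.2.1 K hK).1.image e⟩
  have hpre : ⋂₀ ((fun K => upSet Y (e '' K)) '' 𝒦) ⊆ r ⁻¹' U := by
    intro y hy
    refine hsub fun K hK => ?_
    obtain ⟨_, ⟨k, hk, rfl⟩, hky⟩ := hy _ (mem_image_of_mem _ hK)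
    have h := (specializes_iff_mem_closure.2 hky).map hr
    rw [hre k] at h
    exact (h𝒦.2.1 K hK).2.2 k hk _ (specializes_iff_mem_closure.1 h)
  obtain ⟨_, ⟨K, hK, rfl⟩, hKU⟩ := hY _ hfam (r ⁻¹' U) (hU.preimage hr) hpre
  refine ⟨K, hK, fun k hk => ?_⟩
  have := hKU (subset_upSet _ (mem_image_of_mem e hk))
  rwa [mem_preimage, hre k] at this

/-- Rudin's lemma: a closed set meeting every member of a filtered family of compact
saturated sets contains a minimal such closed set. -/
theorem FilteredFamily.exists_minimal_isClosed {X : Type u} [TopologicalSpace X]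
    {𝒦 : Set (Set X)} (h𝒦 : FilteredFamily 𝒦) {C : Set X} (hC : IsClosed C)
    (hCK : ∀ K ∈ 𝒦, (C ∩ K).Nonempty) :
    ∃ A ⊆ C, Minimal (fun B : Set X => IsClosed B ∧ ∀ K ∈ 𝒦, (B ∩ K).Nonempty) A := by
  refine zorn_superset_nonempty {B : Set X | IsClosed B ∧ ∀ K ∈ 𝒦, (B ∩ K).Nonempty}
    (fun c hc hchain hne => ?_) C ⟨hC, hCK⟩
  refine ⟨⋂₀ c, ⟨isClosed_sInter fun B hB => (hc hB).1, fun K hK => ?_⟩,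
    fun B hB => sInter_subset_of_mem hB⟩
  rw [inter_comm]
  refine (h𝒦.2.1 K hK).2.1.nonempty_inter_sInter (fun B hB => (hc hB).1) fun t ht hfin => ?_
  obtain ⟨B, hB, hBt⟩ : ∃ B ∈ c, ∀ D ∈ t, B ⊆ D := by
    rcases t.eq_empty_or_nonempty with rfl | htne
    · exact hne.imp fun B hB => ⟨hB, by simp⟩
    · obtain ⟨B, hB⟩ := hfin.exists_minimal htne
      exact ⟨B, ht hB.1, fun D hD => (hchain.total (ht hB.1) (ht hD)).elim id (hB.2 hD)⟩
  obtain ⟨x, hxB, hxK⟩ := (hc hB).2 K hK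
  exact ⟨x, hxK, fun D hD => hBt D hD hxB⟩

theorem WellFiltered.pi {ι : Type u} {X : ι → Type v} [∀ i, TopologicalSpace (X i)]
    (hX : ∀ i, WellFiltered (X i)) : WellFiltered (∀ i, X i) := by
  intro 𝒦 h𝒦 U hU hsub
  by_contra! hcon
  obtain ⟨A, hAU, ⟨hA, hAK⟩, hmin⟩ := h𝒦.exists_minimal_isClosed hU.isClosed_compl
    fun K hK => by
      obtain ⟨x, hxK, hxU⟩ := not_subset.1 (hcon K hK)
      exact ⟨x, hxU, hxK⟩
  have hsubset : ∀ B : Set (∀ i, X i), IsClosed B → (∀ K ∈ 𝒦, (A ∩ B ∩ K).Nonempty) → A ⊆ B :=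
    fun B hB hBK => (hmin ⟨hA.inter hB, hBK⟩ inter_subset_left).trans inter_subset_right
  have hsmall : ∀ V : Set (∀ i, X i), IsOpen V → (A ∩ V).Nonempty → ∃ K ∈ 𝒦, A ∩ K ⊆ V := by
    rintro V hV ⟨a, haA, haV⟩
    by_contra! h
    refine hsubset Vᶜ hV.isClosed_compl (fun K hK => ?_) haA haV
    obtain ⟨x, ⟨hxA, hxK⟩, hxV⟩ := not_subset.1 (h K hK)
    exact ⟨x, ⟨hxA, hxV⟩, hxK⟩
  have hpoint : ∀ i, ∃ x : X i, x ∈ closure ((fun y => y i) '' A) ∧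
      ∀ K ∈ 𝒦, ∃ k ∈ A ∩ K, k i ∈ closure {x} := by
    intro i
    have hfam := h𝒦.image_upSet (fun K => (fun y => y i) '' (A ∩ K))
      (fun _ _ h => image_mono (inter_subset_inter_right A h)) fun K hK =>
        ⟨((h𝒦.2.1 K hK).2.1.inter_left hA).image (continuous_apply i), (hAK K hK).image _⟩
    by_contra! h
    obtain ⟨_, ⟨K, hK, rfl⟩, hKsub⟩ := hX i _ hfam (closure ((fun y => y i) '' A))ᶜ
      isClosed_closure.isOpen_compl fun x hx hxA => by
        obtain ⟨K, hK, hKx⟩ := h x hxA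
        obtain ⟨_, ⟨k, hk, rfl⟩, hkx⟩ := hx _ (mem_image_of_mem _ hK)
        exact hKx k hk hkx
    obtain ⟨k, hk⟩ := hAK K hK
    exact hKsub (subset_upSet _ (mem_image_of_mem _ hk))
      (subset_closure (mem_image_of_mem _ hk.1))
  choose x hxA hxK using hpoint
  have hle : ∀ a ∈ A, a ∈ closure {x} := by
    intro a ha
    rw [← specializes_iff_mem_closure, specializes_pi]
    intro i
    rw [specializes_iff_mem_closure]
    refine hsubset ((fun y => y i) ⁻¹' closure {x i})
      (isClosed_closure.preimage (continuous_apply i)) (fun K hK => ?_) ha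
    obtain ⟨k, ⟨hkA, hkK⟩, hkx⟩ := hxK i K hK
    exact ⟨k, ⟨hkA, hkx⟩, hkK⟩
  have hdir : DirectedOn ((fun K => 𝓟 (A ∩ K)) ⁻¹'o (· ≥ ·)) 𝒦 := by
    intro K₁ h₁ K₂ h₂
    obtain ⟨K₃, h₃, h₃₁, h₃₂⟩ := h𝒦.2.2 K₁ h₁ K₂ h₂
    exact ⟨K₃, h₃, principal_mono.2 (inter_subset_inter_right A h₃₁),
      principal_mono.2 (inter_subset_inter_right A h₃₂)⟩
  set l : Filter (∀ i, X i) := ⨅ K ∈ 𝒦, 𝓟 (A ∩ K) with hl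
  have hmem : ∀ V, V ∈ l ↔ ∃ K ∈ 𝒦, A ∩ K ⊆ V := fun V => by
    simp only [hl, mem_biInf_of_directed hdir h𝒦.1, mem_principal]
  have hne : l.NeBot := by
    refine ⟨fun hbot => ?_⟩
    obtain ⟨K, hK, hKe⟩ := (hmem ∅).1 (empty_mem_iff_bot.2 hbot)
    exact (hAK K hK).not_subset_empty hKe
  have hlim : Tendsto id l (𝓝 x) := by
    refine tendsto_pi_nhds.2 fun i => tendsto_nhds.2 fun V hV hxV => (hmem _).2 ?_
    obtain ⟨_, haV, a, haA, rfl⟩ := mem_closure_iff.1 (hxA i) V hV hxV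
    exact hsmall _ (hV.preimage (continuous_apply i)) ⟨a, haA, haV⟩
  have hxmem : x ∈ A := by
    obtain ⟨K, hK⟩ := h𝒦.1
    exact hA.mem_of_tendsto hlim ((hmem A).2 ⟨K, hK, inter_subset_left⟩)
  refine hAU hxmem (hsub fun K hK => ?_)
  obtain ⟨k, hkA, hkK⟩ := hAK K hK
  exact (h𝒦.2.1 K hK).2.2 k hkK x (hle k hkA)

/-- A product of nonempty T₀ spaces is well-filtered iff every factor is
well-filtered. -/
theorem stmt18 {ι : Type u} (X : ι → Type v) [∀ i, TopologicalSpace (X i)]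
    [∀ i, T0Space (X i)] [∀ i, Nonempty (X i)] :
    WellFiltered (∀ i, X i) ↔ ∀ i, WellFiltered (X i) := by
  classical
  refine ⟨fun h i => ?_, WellFiltered.pi⟩
  let a : ∀ j, X j := fun j => Classical.arbitrary (X j)
  exact h.of_leftInverse (e := Function.update a i) (r := fun y => y i)
    (continuous_const.update i continuous_id) (continuous_apply i)
    fun x => Function.update_self i x a
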